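/- arXiv:1912.01284 — 5 statements merged into one kernel-verified Lean document; each statement's English description precedes it below -/
import Mathlib

section
/- Fix γ ∈ ℂ and let U_γ = {z ∈ ℂ : Re(z − γ) > 0}. In the commutative ring of all functions U_γ → ℂ (with pointwise operations), the family consisting of the identity function z ↦ z together with the functions z ↦ exp(1/(z + n − γ)) for all n ∈ ℕ is algebraically independent over ℂ. (This is equivalent to the paper's Lemma that the translates exp(1/(x−γ)), exp(1/(x+1−γ)), exp(1/(x+2−γ)), … are algebraically independent over the rational function field ℂ(x).) -/
open Filter Topology in
/-- If a polynomial in `exp (1 / (z - c))` whose coefficients are analytic at `c` vanishes near `c`,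
then its top coefficient vanishes near `c`. -/
theorem eventually_eq_zero_of_sum_mul_exp_pow {c : ℂ} {d : ℕ} {A : ℕ → ℂ → ℂ}
    (hA : ∀ k, AnalyticAt ℂ (A k) c)
    (h : ∀ᶠ z in 𝓝[≠] c,
      ∑ k ∈ Finset.range (d + 1), A k z * Complex.exp (1 / (z - c)) ^ k = 0) :
    ∀ᶠ z in 𝓝 c, A d z = 0 := by
  by_contra hne
  obtain ⟨p, g, hg, hgc, hev⟩ := (hA d).exists_eventuallyEq_pow_smul_nonzero_iff.mpr hne
  have ht : Tendsto (fun x : ℝ => c + ((x⁻¹ : ℝ) : ℂ)) atTop (𝓝 c) := by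
    have h0 : Tendsto (fun x : ℝ => ((x⁻¹ : ℝ) : ℂ)) atTop (𝓝 ((0 : ℝ) : ℂ)) :=
      (Complex.continuous_ofReal.tendsto 0).comp tendsto_inv_atTop_zero
    simpa using h0.const_add c
  have ht' : Tendsto (fun x : ℝ => c + ((x⁻¹ : ℝ) : ℂ)) atTop (𝓝[≠] c) := by
    refine tendsto_nhdsWithin_iff.mpr ⟨ht, ?_⟩
    filter_upwards [eventually_gt_atTop 0] with x hx
    simp [hx.ne']
  have hdecay : ∀ k ∈ Finset.range d, Tendsto
      (fun x : ℝ => ((x ^ p * Real.exp (-((d : ℝ) - k) * x) : ℝ) : ℂ)) atTop (𝓝 0) := by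
    intro k hk
    have hk' : (0 : ℝ) < (d : ℝ) - k := by
      simpa using Finset.mem_range.mp hk
    have := tendsto_rpow_mul_exp_neg_mul_atTop_nhds_zero p _ hk'
    simp only [Real.rpow_natCast] at this
    exact Complex.ofReal_zero ▸ (Complex.continuous_ofReal.tendsto 0).comp this
  have hlim : Tendsto (fun x : ℝ => -∑ k ∈ Finset.range d, A k (c + ((x⁻¹ : ℝ) : ℂ)) *
      ((x ^ p * Real.exp (-((d : ℝ) - k) * x) : ℝ) : ℂ)) atTop (𝓝 0) := by
    have := tendsto_finsetSum (Finset.range d) fun k hk =>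
      ((hA k).continuousAt.tendsto.comp ht).mul (hdecay k hk)
    simpa using this.neg
  refine hgc (tendsto_nhds_unique (hg.continuousAt.tendsto.comp ht) (hlim.congr' ?_))
  filter_upwards [ht'.eventually h, ht.eventually hev, eventually_gt_atTop 0] with x hx hx' hx0
  have hxC : (x : ℂ) ≠ 0 := by exact_mod_cast hx0.ne'
  rw [Finset.sum_range_succ, hx'] at hx
  simp only [add_sub_cancel_left, smul_eq_mul, one_div, Complex.ofReal_inv, inv_inv] at hx
  have hexp : ∀ k : ℕ, Complex.exp x ^ k * Complex.exp (-((d : ℂ) * x)) =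
      Complex.exp (-((d : ℂ) - k) * x) := by
    intro k
    rw [← Complex.exp_nat_mul, ← Complex.exp_add]
    ring_nf
  have hmul := congrArg (fun w => w * ((x : ℂ) ^ p * Complex.exp (-((d : ℂ) * x)))) hx
  simp only [add_mul, Finset.sum_mul, zero_mul] at hmul
  have htop : (x : ℂ)⁻¹ ^ p * g (c + (x : ℂ)⁻¹) * Complex.exp x ^ d *
      ((x : ℂ) ^ p * Complex.exp (-((d : ℂ) * x))) = g (c + (x : ℂ)⁻¹) := by
    calc _ = ((x : ℂ)⁻¹ * x) ^ p * g (c + (x : ℂ)⁻¹) *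
          (Complex.exp x ^ d * Complex.exp (-((d : ℂ) * x))) := by ring
      _ = _ := by rw [hexp, inv_mul_cancel₀ hxC]; simp
  rw [htop] at hmul
  simp only [Function.comp_apply, Complex.ofReal_inv]
  rw [eq_neg_of_add_eq_zero_right hmul, neg_inj]
  refine Finset.sum_congr rfl fun k _ => ?_
  push_cast
  rw [← hexp]
  ring

/-- The functions on a subtype of `ℂ` that are restrictions of functions analytic on `Ω`. -/
def analyticRestrictions (p : ℂ → Prop) (Ω : Set ℂ) : Subalgebra ℂ ({z : ℂ // p z} → ℂ) where
  carrier := {f | ∃ F : ℂ → ℂ, AnalyticOnNhd ℂ F Ω ∧ ∀ z : {z : ℂ // p z}, F z = f z}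
  mul_mem' := by
    rintro f g ⟨F, hF, hf⟩ ⟨G, hG, hg⟩
    exact ⟨F * G, hF.mul hG, fun z => by simp [hf, hg]⟩
  add_mem' := by
    rintro f g ⟨F, hF, hf⟩ ⟨G, hG, hg⟩
    exact ⟨F + G, hF.add hG, fun z => by simp [hf, hg]⟩
  algebraMap_mem' a := ⟨fun _ => a, analyticOnNhd_const, fun _ => rfl⟩

theorem analyticAt_exp_one_div {a z : ℂ} (h : z + a ≠ 0) :
    AnalyticAt ℂ (fun w => Complex.exp (1 / (w + a))) z :=
  (analyticAt_const.div (analyticAt_id.add analyticAt_const) h).cexp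

theorem Set.Countable.isPreconnected_compl {S : Set ℂ} (hS : S.Countable) : IsPreconnected Sᶜ :=
  (hS.isPathConnected_compl_of_one_lt_rank (by simp)).isConnected.isPreconnected

open Filter Topology Polynomial in
/-- On a nonempty open set, `exp (1 / (z - c))` is transcendental over any algebra of functions
that extend analytically to a co-countable set containing `c`. -/
theorem transcendental_exp_one_div_sub {p : ℂ → Prop} (hp : IsOpen {z | p z}) {u : ℂ} (hu : p u)
    {S : Set ℂ} (hS : S.Countable) (hSp : ∀ z, p z → z ∉ S) {c : ℂ} (hc : c ∉ S) (hcp : ¬ p c)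
    (hSc : Sᶜ ∈ 𝓝 c)
    {B : Subalgebra ℂ ({z : ℂ // p z} → ℂ)} (hB : B ≤ analyticRestrictions p Sᶜ) :
    Transcendental B (fun z : {z : ℂ // p z} => Complex.exp (1 / ((z : ℂ) - c))) := by
  rw [transcendental_iff]
  intro P hP
  by_contra hP0
  have hcoeff : ∀ k, ∃ F : ℂ → ℂ, AnalyticOnNhd ℂ F Sᶜ ∧
      ∀ z : {z : ℂ // p z}, F z = (P.coeff k : {z : ℂ // p z} → ℂ) z :=
    fun k => hB (P.coeff k).2
  choose A hA hAP using hcoeff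
  have hsum : AnalyticOnNhd ℂ (fun z => ∑ k ∈ Finset.range (P.natDegree + 1),
      A k z * Complex.exp (1 / (z - c)) ^ k) (insert c S)ᶜ := by
    intro z hz
    simp only [Set.mem_compl_iff, Set.mem_insert_iff, not_or] at hz
    refine Finset.analyticAt_fun_sum _ fun k _ => (hA k z hz.2).mul (AnalyticAt.pow ?_ k)
    simpa [sub_eq_add_neg] using
      analyticAt_exp_one_div (a := -c) (z := z) (by simpa [← sub_eq_add_neg, sub_eq_zero] using hz.1)
  have hnhds : ∀ᶠ z in 𝓝 u, p z := hp.mem_nhds hu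
  have hzero := hsum.eqOn_zero_of_preconnected_of_eventuallyEq_zero
    (hS.insert c).isPreconnected_compl (z₀ := u)
    (by
      simp only [Set.mem_compl_iff, Set.mem_insert_iff, not_or]
      exact ⟨fun h => hcp (h ▸ hu), hSp u hu⟩)
    (by
      filter_upwards [hnhds] with z hz
      have := congrFun hP ⟨z, hz⟩
      rw [aeval_eq_sum_range] at this
      simpa [Algebra.smul_def, ← hAP] using this)
  have hlead := eventually_eq_zero_of_sum_mul_exp_pow (d := P.natDegree) (fun k => hA k c hc) (by
    filter_upwards [self_mem_nhdsWithin, mem_nhdsWithin_of_mem_nhds hSc] with z hz hzS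
    refine hzero ?_
    simp only [Set.mem_compl_iff, Set.mem_insert_iff, not_or]
    exact ⟨hz, hzS⟩)
  have hA0 := (hA P.natDegree).eqOn_zero_of_preconnected_of_eventuallyEq_zero
    hS.isPreconnected_compl hc hlead
  refine hP0 (leadingCoeff_eq_zero.mp (Subtype.ext (funext fun z => ?_)))
  rw [leadingCoeff, ← hAP]
  exact hA0 (hSp z z.2)

/-- The identity function together with the translates
`z ↦ exp (1/(z + n - γ))`, `n ∈ ℕ`, are algebraically independent over `ℂ`
in the ring of all functions on `U_γ = {z : Re (z - γ) > 0}`. -/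
theorem translates_exp_algebraicallyIndependent (γ : ℂ) :
    AlgebraicIndependent ℂ
      (fun i : Option ℕ => fun z : {z : ℂ // 0 < (z - γ).re} =>
        Option.elim i (z : ℂ)
          (fun n : ℕ => Complex.exp (1 / ((z : ℂ) + (n : ℂ) - γ)))) := by
  have hopen : IsOpen {z : ℂ | 0 < (z - γ).re} :=
    isOpen_lt continuous_const (by fun_prop)
  have hmem : 0 < ((γ + 1) - γ).re := by simp
  refine algebraicIndependent_of_set_of_finite {none} ?_ ?_
  · rw [algebraicIndependent_unique_type_iff, transcendental_iff]
    intro P hP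
    refine P.eq_zero_of_infinite_isRoot ((infinite_of_mem_nhds _ (hopen.mem_nhds hmem)).mono ?_)
    intro z hz
    have := congrFun hP ⟨z, hz⟩
    rw [Polynomial.aeval_eq_sum_range] at this
    simpa [Polynomial.IsRoot, Polynomial.eval_eq_sum_range] using this
  · intro t ht _ i hi hit
    obtain _ | n := i
    · simp at hi
    let S : Set ℂ := (fun m : ℕ => γ - m) '' {m | some m ∈ t}
    have hSfin : S.Finite := (ht.preimage (Option.some_injective _).injOn).image _
    have hcS : γ - n ∉ S := by
      rintro ⟨m, hm, hmn⟩
      obtain rfl : m = n := by simpa using hmn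
      exact hit hm
    have key := transcendental_exp_one_div_sub (p := fun z => 0 < (z - γ).re) hopen hmem
      hSfin.countable (by rintro z hz ⟨m, -, rfl⟩; simp at hz; linarith [m.cast_nonneg (α := ℝ)])
      (c := γ - n) hcS (by simp) (hSfin.isClosed.isOpen_compl.mem_nhds hcS)
      (B := Algebra.adjoin ℂ ((fun i : Option ℕ => fun z : {z : ℂ // 0 < (z - γ).re} =>
        Option.elim i (z : ℂ)
          (fun n : ℕ => Complex.exp (1 / ((z : ℂ) + (n : ℂ) - γ)))) '' t)) (by
        refine Algebra.adjoin_le ?_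
        rintro _ ⟨_ | m, hm, rfl⟩
        · exact ⟨id, analyticOnNhd_id, fun _ => rfl⟩
        · refine ⟨fun z => Complex.exp (1 / (z + (m - γ))), fun z hz => ?_, fun z => ?_⟩
          · refine analyticAt_exp_one_div fun h => hz ⟨m, hm, ?_⟩
            linear_combination -h
          · simp [add_sub_assoc])
    simpa [sub_sub_eq_add_sub] using key
end

section
/- Fix γ ∈ ℂ and let U_γ = {z ∈ ℂ : Re(z − γ) > 0}. In the commutative ring of all functions U_γ → ℂ (with pointwise operations), the family consisting of the identity function z ↦ z together with the functions z ↦ log(1/(z + n − γ) + 1) for all n ∈ ℕ is algebraically independent over ℂ. (This is equivalent to the paper's Lemma that the translates log(1/(x−γ)+1), log(1/(x+1−γ)+1), log(1/(x+2−γ)+1), … are algebraically independent over the rational function field ℂ(x).) -/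
/-- A point of affine space whose coordinates are `w + γ` and, for each `n`, the difference of
logarithms `log (w + n + 1) - log (w + n)` shifted by the constant `g n`. -/
noncomputable def shiftedLogPoint (γ : ℂ) (g : ℕ → ℂ) (w : ℂ) (i : Option ℕ) : ℂ :=
  i.elim (w + γ) fun n =>
    Complex.log (w + ((n + 1 : ℕ) : ℂ)) - Complex.log (w + (n : ℂ)) + g n

/-- The logarithm of `w + j`, cut along the negative axis for `j > k` and along the positive axis
for `j ≤ k`. -/
noncomputable def logBranch (k j : ℕ) (w : ℂ) : ℂ :=
  if j ≤ k then Complex.log (-(w + (j : ℂ))) + Real.pi * Complex.I else Complex.log (w + (j : ℂ))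

/-- A point of affine space built like `shiftedLogPoint`, but from the branches `logBranch k`. -/
noncomputable def continuedLogPoint (γ : ℂ) (g : ℕ → ℂ) (k : ℕ) (w : ℂ) (i : Option ℕ) : ℂ :=
  i.elim (w + γ) fun n => logBranch k (n + 1) w - logBranch k n w + g n

theorem Complex.log_neg_of_im_pos {v : ℂ} (hv : 0 < v.im) :
    log (-v) = log v - Real.pi * I := by
  simp only [log, norm_neg, arg_neg_eq_arg_sub_pi_of_im_pos hv, ofReal_sub]
  ring

theorem Complex.log_neg_of_im_neg {v : ℂ} (hv : v.im < 0) :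
    log (-v) = log v + Real.pi * I := by
  simp only [log, norm_neg, arg_neg_eq_arg_add_pi_of_im_neg hv, ofReal_add]
  ring

theorem Complex.log_one_div_add_one {v : ℂ} (hv : 0 < v.re) :
    log (1 / v + 1) = log (v + 1) - log v := by
  have hv0 : v ≠ 0 := by rintro rfl; simp at hv
  have hx : 0 < (1 / v + 1).re := by
    have : 0 < normSq v := normSq_pos.2 hv0
    rw [add_re, one_div, inv_re, one_re]
    positivity
  have hx0 : 1 / v + 1 ≠ 0 := by intro h; rw [h] at hx; simp at hx
  have h1 := abs_lt.1 (abs_arg_lt_pi_div_two_iff.2 (Or.inl hv))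
  have h2 := abs_lt.1 (abs_arg_lt_pi_div_two_iff.2 (Or.inl hx))
  have h := (log_mul_eq_add_log_iff hx0 hv0).2 ⟨by linarith, by linarith⟩
  rw [show (1 / v + 1) * v = v + 1 by field_simp; ring] at h
  rw [h]; ring

theorem Complex.add_natCast_mem_slitPlane {w : ℂ} (hw : w ∈ slitPlane) (n : ℕ) :
    w + (n : ℂ) ∈ slitPlane := by
  rw [mem_slitPlane_iff] at hw ⊢
  rcases hw with h | h
  · left
    simp only [add_re, natCast_re]
    positivity
  · right
    simpa using h

theorem Complex.isPreconnected_slitPlane : IsPreconnected slitPlane :=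
  (starConvex_one_slitPlane.isPathConnected one_mem_slitPlane).isConnected.isPreconnected

theorem AnalyticOnNhd.eqOn_zero_of_isOpen {F : ℂ → ℂ} {S V : Set ℂ} (hF : AnalyticOnNhd ℂ F S)
    (hS : IsPreconnected S) (hV : IsOpen V) (hVS : V ⊆ S) (hne : V.Nonempty)
    (h : ∀ w ∈ V, F w = 0) : ∀ w ∈ S, F w = 0 := by
  obtain ⟨w₀, hw₀⟩ := hne
  exact hF.eqOn_zero_of_preconnected_of_eventuallyEq_zero hS (hVS hw₀)
    (Filter.eventually_of_mem (hV.mem_nhds hw₀) h)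

theorem analyticOnNhd_aeval_shiftedLogPoint (γ : ℂ) (g : ℕ → ℂ) (P : MvPolynomial (Option ℕ) ℂ) :
    AnalyticOnNhd ℂ (fun w => MvPolynomial.aeval (shiftedLogPoint γ g w) P)
      Complex.slitPlane := by
  refine AnalyticOnNhd.aeval_mvPolynomial (fun i w hw => ?_) P
  cases i with
  | none => exact analyticAt_id.add analyticAt_const
  | some n =>
    exact (((analyticAt_id.add analyticAt_const).clog
      (Complex.add_natCast_mem_slitPlane hw (n + 1))).sub
      ((analyticAt_id.add analyticAt_const).clog
        (Complex.add_natCast_mem_slitPlane hw n))).add analyticAt_const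

theorem analyticAt_logBranch {k j : ℕ} {w : ℂ} (h1 : -(k : ℝ) - 1 < w.re) (h2 : w.re < -(k : ℝ)) :
    AnalyticAt ℂ (logBranch k j) w := by
  unfold logBranch
  split_ifs with hj
  · refine (AnalyticAt.clog (analyticAt_id.add analyticAt_const).neg ?_).add analyticAt_const
    refine Complex.mem_slitPlane_iff.2 (Or.inl ?_)
    have : (j : ℝ) ≤ k := by exact_mod_cast hj
    simp
    linarith
  · refine AnalyticAt.clog (analyticAt_id.add analyticAt_const) ?_
    refine Complex.mem_slitPlane_iff.2 (Or.inl ?_)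
    have : (k : ℝ) + 1 ≤ j := by exact_mod_cast not_le.1 hj
    simp
    linarith

theorem analyticOnNhd_aeval_continuedLogPoint (γ : ℂ) (g : ℕ → ℂ) (k : ℕ)
    (P : MvPolynomial (Option ℕ) ℂ) :
    AnalyticOnNhd ℂ (fun w => MvPolynomial.aeval (continuedLogPoint γ g k w) P)
      {w | -(k : ℝ) - 1 < w.re ∧ w.re < -(k : ℝ)} := by
  refine AnalyticOnNhd.aeval_mvPolynomial (fun i w hw => ?_) P
  cases i with
  | none => exact analyticAt_id.add analyticAt_const
  | some n =>
    exact ((analyticAt_logBranch hw.1 hw.2).sub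
      (analyticAt_logBranch hw.1 hw.2)).add analyticAt_const

theorem continuedLogPoint_of_im_pos (γ : ℂ) (g : ℕ → ℂ) (k : ℕ) {w : ℂ} (hw : 0 < w.im) :
    continuedLogPoint γ g k w = shiftedLogPoint γ g w := by
  have h (j : ℕ) : logBranch k j w = Complex.log (w + (j : ℂ)) := by
    unfold logBranch
    split_ifs
    · rw [Complex.log_neg_of_im_pos (by simpa using hw)]
      ring
    · rfl
  funext i
  cases i <;> simp [continuedLogPoint, shiftedLogPoint, h]

theorem continuedLogPoint_of_im_neg (γ : ℂ) (g : ℕ → ℂ) (k : ℕ) {w : ℂ} (hw : w.im < 0) :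
    continuedLogPoint γ g k w =
      shiftedLogPoint γ (Function.update g k (g k - 2 * Real.pi * Complex.I)) w := by
  have h (j : ℕ) : logBranch k j w =
      Complex.log (w + (j : ℂ)) + if j ≤ k then 2 * Real.pi * Complex.I else 0 := by
    unfold logBranch
    split_ifs
    · rw [Complex.log_neg_of_im_neg (by simpa using hw)]
      ring
    · rw [add_zero]
  funext i
  cases i with
  | none => rfl
  | some n =>
    simp only [continuedLogPoint, shiftedLogPoint, h, Option.elim]
    rcases lt_trichotomy n k with hn | rfl | hn
    · rw [if_pos (by omega), if_pos (by omega), Function.update_of_ne hn.ne]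
      ring
    · rw [if_neg (by omega), if_pos le_rfl, Function.update_self]
      ring
    · rw [if_neg (by omega), if_neg (by omega), Function.update_of_ne hn.ne']
      ring

/-- Monodromy around the branch point of `log (w + k)`. -/
theorem aeval_shiftedLogPoint_update_eq_zero {γ : ℂ} {g : ℕ → ℂ} {P : MvPolynomial (Option ℕ) ℂ}
    (h : ∀ w ∈ Complex.slitPlane, MvPolynomial.aeval (shiftedLogPoint γ g w) P = 0) (k : ℕ) :
    ∀ w ∈ Complex.slitPlane, MvPolynomial.aeval
      (shiftedLogPoint γ (Function.update g k (g k - 2 * Real.pi * Complex.I)) w) P = 0 := by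
  set S : Set ℂ := {w | -(k : ℝ) - 1 < w.re ∧ w.re < -(k : ℝ)} with hS
  have hSo : IsOpen S := (isOpen_lt continuous_const Complex.continuous_re).inter
    (isOpen_lt Complex.continuous_re continuous_const)
  have hSc : Convex ℝ S := (convex_halfSpace_re_gt _).inter (convex_halfSpace_re_lt _)
  have hG : ∀ w ∈ S, MvPolynomial.aeval (continuedLogPoint γ g k w) P = 0 := by
    refine (analyticOnNhd_aeval_continuedLogPoint γ g k P).eqOn_zero_of_isOpen hSc.isPreconnected
      (V := S ∩ {w | 0 < w.im})
      (hSo.inter (isOpen_lt continuous_const Complex.continuous_im)) Set.inter_subset_left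
      ⟨⟨-(k : ℝ) - 1 / 2, 1⟩, ?_⟩ fun w hw => ?_
    · simp only [hS, Set.mem_inter_iff, Set.mem_ofPred_eq]
      norm_num
    · rw [continuedLogPoint_of_im_pos γ g k hw.2]
      exact h w (Complex.mem_slitPlane_iff.2 (Or.inr hw.2.ne'))
  refine (analyticOnNhd_aeval_shiftedLogPoint γ _ P).eqOn_zero_of_isOpen
    Complex.isPreconnected_slitPlane (V := S ∩ {w | w.im < 0})
    (hSo.inter (isOpen_lt Complex.continuous_im continuous_const))
    (fun w hw => Complex.mem_slitPlane_iff.2 (Or.inr hw.2.ne))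
    ⟨⟨-(k : ℝ) - 1 / 2, -1⟩, ?_⟩ fun w hw => ?_
  · simp only [hS, Set.mem_inter_iff, Set.mem_ofPred_eq]
    norm_num
  · rw [← continuedLogPoint_of_im_neg γ g k hw.2]
    exact hG w hw.1

theorem aeval_shiftedLogPoint_finsupp_eq_zero {γ : ℂ} {P : MvPolynomial (Option ℕ) ℂ}
    (h : ∀ w ∈ Complex.slitPlane, MvPolynomial.aeval (shiftedLogPoint γ 0 w) P = 0)
    (m : ℕ →₀ ℕ) :
    ∀ w ∈ Complex.slitPlane, MvPolynomial.aeval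
      (shiftedLogPoint γ (fun n => -(m n * (2 * Real.pi * Complex.I))) w) P = 0 := by
  suffices H : ∀ (N : ℕ) (m : ℕ →₀ ℕ), m.degree = N → ∀ w ∈ Complex.slitPlane, MvPolynomial.aeval
      (shiftedLogPoint γ (fun n => -(m n * (2 * Real.pi * Complex.I))) w) P = 0 from H _ m rfl
  clear m
  intro N
  induction N with
  | zero =>
    intro m hm
    obtain rfl := (Finsupp.degree_eq_zero_iff m).1 hm
    simpa [← Pi.zero_def] using h
  | succ N ih =>
    intro m hm
    obtain ⟨k, hk⟩ : ∃ k, m k ≠ 0 := by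
      by_contra! hm0
      simp [show m = 0 from Finsupp.ext hm0] at hm
    obtain ⟨m', rfl⟩ : ∃ m', m = m' + Finsupp.single k 1 :=
      ⟨m - Finsupp.single k 1,
        (tsub_add_cancel_of_le (by simpa using Nat.one_le_iff_ne_zero.2 hk)).symm⟩
    have hdeg : m'.degree = N := by simpa using hm
    convert! aeval_shiftedLogPoint_update_eq_zero (ih m' hdeg) k using 6 with w hw
    funext n
    rcases eq_or_ne n k with rfl | hn
    · simp
      ring
    · simp [hn]

/-- A polynomial vanishing along the family of points `shiftedLogPoint γ 0` is zero. -/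
theorem eq_zero_of_aeval_shiftedLogPoint_eq_zero {γ : ℂ} {P : MvPolynomial (Option ℕ) ℂ}
    (h : ∀ w ∈ Complex.slitPlane, MvPolynomial.aeval (shiftedLogPoint γ 0 w) P = 0) : P = 0 := by
  have key : ∀ w ∈ Complex.slitPlane, ∀ y : ℕ → ℂ,
      MvPolynomial.aeval (fun i : Option ℕ => i.elim (w + γ) y) P = 0 := by
    intro w hw
    have heval (y : ℕ → ℂ) : MvPolynomial.eval y (MvPolynomial.aeval
        (fun i : Option ℕ => i.elim (MvPolynomial.C (w + γ)) MvPolynomial.X) P) =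
        MvPolynomial.aeval (fun i : Option ℕ => i.elim (w + γ) y) P := by
      rw [← MvPolynomial.coe_aeval_eq_eval, RingHom.coe_coe, ← AlgHom.comp_apply,
        MvPolynomial.comp_aeval]
      congr 2
      funext i
      cases i <;> simp
    suffices hQ : MvPolynomial.aeval
        (fun i : Option ℕ => i.elim (MvPolynomial.C (w + γ)) MvPolynomial.X) P =
        (0 : MvPolynomial ℕ ℂ) by
      intro y
      rw [← heval, hQ, map_zero]
    refine MvPolynomial.funext_set
      (fun n => Set.range fun m : ℕ => Complex.log (w + ((n + 1 : ℕ) : ℂ)) - Complex.log (w + n) +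
        -(m * (2 * Real.pi * Complex.I))) (fun n => ?_) fun y hy => ?_
    · refine Set.infinite_range_of_injective fun a b hab => ?_
      simpa [Complex.I_ne_zero, Real.pi_ne_zero] using hab
    · choose m hm using fun n => hy n (Set.mem_univ n)
      rw [heval, map_zero]
      let s : Finset ℕ := P.vars.preimage some (Option.some_injective ℕ).injOn
      rw [← aeval_shiftedLogPoint_finsupp_eq_zero h
        (Finsupp.onFinset s (fun n => if n ∈ s then m n else 0) (by simp +contextual)) w hw]
      refine MvPolynomial.eval₂Hom_congr' rfl (fun i hi _ => ?_) rfl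
      cases i with
      | none => rfl
      | some n =>
        have hn : n ∈ s := Finset.mem_preimage.2 hi
        simp only [shiftedLogPoint, Option.elim, Finsupp.onFinset_apply, if_pos hn]
        exact (hm n).symm
  refine MvPolynomial.funext_set
    (fun i : Option ℕ => i.elim ((· + γ) '' Complex.slitPlane) fun _ => Set.univ)
    (fun i => ?_) fun x hx => ?_
  · cases i with
    | none =>
      exact (infinite_of_mem_nhds 1 (Complex.isOpen_slitPlane.mem_nhds
        Complex.one_mem_slitPlane)).image (add_left_injective γ).injOn
    | some n => exact Set.infinite_univ
  · obtain ⟨w, hw, hwx⟩ := hx none (Set.mem_univ _)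
    have hx' : x = fun i : Option ℕ => i.elim (w + γ) fun n => x (some n) := by
      funext i
      cases i with
      | none => exact hwx.symm
      | some n => rfl
    rw [map_zero, hx', ← key w hw fun n => x (some n)]
    rfl

/-- The identity function together with the translates
`z ↦ log (1/(z + n - γ) + 1)`, `n ∈ ℕ`, are algebraically independent over `ℂ`
in the ring of all functions on `U_γ = {z : Re (z - γ) > 0}`. -/
theorem translates_log_algebraicallyIndependent (γ : ℂ) :
    AlgebraicIndependent ℂ
      (fun i : Option ℕ => fun z : {z : ℂ // 0 < (z - γ).re} =>
        Option.elim i (z : ℂ)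
          (fun n : ℕ => Complex.log (1 / ((z : ℂ) + (n : ℂ) - γ) + 1))) := by
  refine algebraicIndependent_iff.2 fun P hP => eq_zero_of_aeval_shiftedLogPoint_eq_zero (γ := γ) ?_
  refine (analyticOnNhd_aeval_shiftedLogPoint γ 0 P).eqOn_zero_of_isOpen
    Complex.isPreconnected_slitPlane (V := {w | 0 < w.re})
    (isOpen_lt continuous_const Complex.continuous_re)
    (fun w hw => Complex.mem_slitPlane_iff.2 (Or.inl hw)) ⟨1, by simp⟩ fun w hw => ?_
  let z : {z : ℂ // 0 < (z - γ).re} := ⟨w + γ, by simpa using hw⟩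
  have h := congrArg (Pi.evalAlgHom ℂ (fun _ : {z : ℂ // 0 < (z - γ).re} => ℂ) z) hP
  rw [← AlgHom.comp_apply, MvPolynomial.comp_aeval, map_zero] at h
  rw [← h]
  congr 2
  funext i
  cases i with
  | none => rfl
  | some n =>
    have hv : 0 < (w + (n : ℂ)).re := by
      have hw' : 0 < w.re := hw
      simp only [Complex.add_re, Complex.natCast_re]
      positivity
    have hz : (z : ℂ) + n - γ = w + n := by simp only [z]; ring
    simp only [shiftedLogPoint, Option.elim, Pi.evalAlgHom_apply, hz,
      Complex.log_one_div_add_one hv, Pi.zero_apply, add_zero]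
    push_cast
    rw [add_assoc]
end

section
/- Let γ ∈ ℂ, j ∈ ℕ, and let d ≥ 1 be an integer. In the polynomial ring over the field ℂ(x) of rational functions in one variable over ℂ, the polynomial Y^d − (x + j + 1 − γ)/(x + j − γ) is irreducible. (Hence adjoining a d-th root of (x+j+1−γ)/(x+j−γ) gives a field extension of ℂ(x) of degree exactly d.) -/
open Polynomial in
/-- If `p` is prime and coprime to `q`, then `C q * X ^ d - C p` is irreducible, by Eisenstein's
criterion at `p`. -/
theorem irreducible_C_mul_X_pow_sub_C {R : Type*} [CommRing R] [IsDomain R] {p q : R}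
    (hp : Prime p) (hpq : IsCoprime p q) {d : ℕ} (hd : 1 ≤ d) :
    Irreducible (C q * X ^ d - C p : R[X]) ∧ (C q * X ^ d - C p : R[X]).IsPrimitive := by
  have hd0 : d ≠ 0 := by lia
  have hq0 : q ≠ 0 := by
    rintro rfl
    exact hp.not_isUnit (isCoprime_zero_right.mp hpq)
  have hpq' : ¬ p ∣ q := fun h => hp.not_isUnit (hpq.isUnit_of_dvd' dvd_rfl h)
  have hcoeff (n : ℕ) : (C q * X ^ d - C p : R[X]).coeff n =
      (if n = d then q else 0) - (if n = 0 then p else 0) := by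
    simp [coeff_C]
  have hdeg : (C q * X ^ d - C p : R[X]).degree = d := by
    rw [degree_sub_C, degree_C_mul_X_pow d hq0]
    rw [degree_C_mul_X_pow d hq0]
    exact_mod_cast hd
  have hnat := natDegree_eq_of_degree_eq_some hdeg
  have hprim : (C q * X ^ d - C p : R[X]).IsPrimitive := by
    intro r hr
    rw [C_dvd_iff_dvd_coeff] at hr
    refine hpq.isUnit_of_dvd' ?_ ?_
    · simpa [hcoeff, hd0.symm] using hr 0
    · simpa [hcoeff, hd0] using hr d
  refine ⟨irreducible_of_eisenstein_criterion
    ((Ideal.span_singleton_prime hp.ne_zero).mpr hp) ?_ ?_ ?_ ?_ hprim, hprim⟩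
  · rw [leadingCoeff, hnat, hcoeff, Ideal.mem_span_singleton]
    simpa [hd0] using hpq'
  · intro n hn
    rw [hdeg] at hn
    have hn' : n ≠ d := by
      rintro rfl
      exact lt_irrefl _ hn
    rw [hcoeff, Ideal.mem_span_singleton]
    by_cases h : n = 0 <;> simp [hn', h, hd0.symm]
  · rw [hdeg]
    exact_mod_cast hd
  · rw [hcoeff, Ideal.span_singleton_pow, Ideal.mem_span_singleton]
    simp only [hd0.symm, if_false, if_true, zero_sub, dvd_neg]
    rintro ⟨c, hc⟩
    refine hp.not_isUnit (IsUnit.of_mul_eq_one c (mul_left_cancel₀ hp.ne_zero ?_))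
    linear_combination -hc

open Polynomial in
/-- Over the fraction field of a GCD domain, `X ^ d - C (p / q)` is irreducible whenever `p` is
prime and coprime to `q`. -/
theorem irreducible_X_pow_sub_C_div {R K : Type*} [CommRing R] [IsDomain R]
    [IsGCDMonoid R] [Field K] [Algebra R K] [IsFractionRing R K] {p q : R}
    (hp : Prime p) (hpq : IsCoprime p q) {d : ℕ} (hd : 1 ≤ d) :
    Irreducible (X ^ d - C (algebraMap R K p / algebraMap R K q) : K[X]) := by
  obtain ⟨hirr, hprim⟩ := irreducible_C_mul_X_pow_sub_C hp hpq hd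
  rw [hprim.irreducible_iff_irreducible_map_fraction_map (K := K)] at hirr
  have hq0 : algebraMap R K q ≠ 0 := by
    rw [Ne, IsFractionRing.to_map_eq_zero_iff]
    rintro rfl
    exact hp.not_isUnit (isCoprime_zero_right.mp hpq)
  have hmul : (C q * X ^ d - C p : R[X]).map (algebraMap R K) =
      C (algebraMap R K q) * (X ^ d - C (algebraMap R K p / algebraMap R K q)) := by
    rw [mul_sub, ← C_mul, mul_div_cancel₀ _ hq0]
    simp
  rwa [hmul, irreducible_isUnit_mul (isUnit_C.mpr hq0.isUnit)] at hirr

/-- Over the rational function field `ℂ(x)`, the polynomial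
`Y^d - (x + j + 1 - γ)/(x + j - γ)` is irreducible for every `d ≥ 1`. -/
theorem irreducible_X_pow_sub_shift_quotient (γ : ℂ) (j : ℕ) (d : ℕ) (hd : 1 ≤ d) :
    Irreducible
      ((Polynomial.X : Polynomial (RatFunc ℂ)) ^ d -
        Polynomial.C
          ((RatFunc.X + (j : RatFunc ℂ) + 1 - RatFunc.C γ) /
            (RatFunc.X + (j : RatFunc ℂ) - RatFunc.C γ))) := by
  have hcop : IsCoprime (Polynomial.X - Polynomial.C (γ - j - 1))
      (Polynomial.X - Polynomial.C (γ - j)) :=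
    Polynomial.isCoprime_X_sub_C_of_isUnit_sub (by simp)
  have hirr := irreducible_X_pow_sub_C_div (K := RatFunc ℂ)
    (Polynomial.prime_X_sub_C (γ - j - 1)) hcop hd
  convert hirr using 4
  · simp
    ring
  · simp
    ring
end

section
/- Let F_0 be a field of characteristic zero equipped with a derivation δ : F_0 → F_0 (additive and satisfying the Leibniz rule), and let F_1, F_2 be subfields of F_0 with δ(F_1) ⊆ F_1 and δ(F_2) ⊆ F_2; set F = F_1 ∩ F_2. Fix n ≥ 1 and let Y_1, Y_2 be invertible n×n matrices over F_0 such that the matrix δ(Y_i)·Y_i^{−1} (δ applied entrywise) has all entries in F_i, for i = 1, 2. Suppose B_1 is an invertible n×n matrix with entries in F_1, and B_2 an invertible n×n matrix with entries in F_2, such that Y_1·Y_2^{−1} = B_1^{−1}·B_2. Then Y := B_1·Y_1 equals B_2·Y_2, and the matrix A := δ(Y)·Y^{−1} has all its entries in F = F_1 ∩ F_2. -/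
/-- `M ∈ GL_n(F₀)` "has entries in the subfield `K`" if all entries of `M` and of
`M⁻¹` lie in `K`. -/
def GLEntriesIn' {F₀ : Type*} [Field F₀] {n : ℕ}
    (M : GL (Fin n) F₀) (K : Subfield F₀) : Prop :=
  (∀ i j, (M : Matrix (Fin n) (Fin n) F₀) i j ∈ K) ∧
    (∀ i j, ((M⁻¹ : GL (Fin n) F₀) : Matrix (Fin n) (Fin n) F₀) i j ∈ K)

theorem Matrix.map_derivation_mul {R A : Type*} [CommRing R] [CommRing A] [Algebra R A]
    {l m n : Type*} [Fintype m] (δ : Derivation R A A) (M : Matrix l m A) (N : Matrix m n A) :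
    (M * N).map δ = M.map δ * N + M * N.map δ := by
  ext i j
  simp only [Matrix.map_apply, Matrix.mul_apply, Matrix.add_apply, map_sum, Derivation.leibniz,
    smul_eq_mul, ← Finset.sum_add_distrib]
  exact Finset.sum_congr rfl fun k _ => by ring

theorem Matrix.mul_apply_mem {A S : Type*} [Semiring A] [SetLike S A] [SubsemiringClass S A]
    {l m n : Type*} [Fintype m] {K : S} {M : Matrix l m A} {N : Matrix m n A}
    (hM : ∀ i j, M i j ∈ K) (hN : ∀ i j, N i j ∈ K) (i : l) (j : n) : (M * N) i j ∈ K := by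
  rw [Matrix.mul_apply]
  exact sum_mem fun k _ => mul_mem (hM i k) (hN k j)

/-- The gauge transformation formula for the logarithmic derivative of a product. -/
theorem Matrix.GeneralLinearGroup.map_derivation_mul_mul_inv {R A : Type*} [CommRing R]
    [CommRing A] [Algebra R A] {n : Type*} [Fintype n] [DecidableEq n] (δ : Derivation R A A)
    (B Y : GL n A) :
    ((B * Y : GL n A) : Matrix n n A).map δ * (((B * Y)⁻¹ : GL n A) : Matrix n n A) =
      (B : Matrix n n A).map δ * ((B⁻¹ : GL n A) : Matrix n n A) +
        (B : Matrix n n A) * ((Y : Matrix n n A).map δ * ((Y⁻¹ : GL n A) : Matrix n n A)) *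
          ((B⁻¹ : GL n A) : Matrix n n A) := by
  rw [_root_.mul_inv_rev, Units.val_mul, Units.val_mul, Matrix.map_derivation_mul, add_mul]
  congr 1
  · rw [mul_assoc, Units.mul_inv_cancel_left]
  · simp only [mul_assoc]

theorem GLEntriesIn'.map_derivation_mul_mul_inv_mem {F₀ : Type*} [Field F₀] {n : ℕ}
    {δ : Derivation ℤ F₀ F₀} {K : Subfield F₀} (hδ : ∀ x ∈ K, δ x ∈ K) {B Y : GL (Fin n) F₀}
    (hB : GLEntriesIn' B K)
    (hY : ∀ i j, (((Y : Matrix (Fin n) (Fin n) F₀).map δ) *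
      ((Y⁻¹ : GL (Fin n) F₀) : Matrix (Fin n) (Fin n) F₀)) i j ∈ K) (i j : Fin n) :
    ((((B * Y : GL (Fin n) F₀) : Matrix (Fin n) (Fin n) F₀).map δ) *
      (((B * Y)⁻¹ : GL (Fin n) F₀) : Matrix (Fin n) (Fin n) F₀)) i j ∈ K := by
  rw [Matrix.GeneralLinearGroup.map_derivation_mul_mul_inv, Matrix.add_apply]
  exact add_mem (Matrix.mul_apply_mem (fun i j => hδ _ (hB.1 i j)) hB.2 i j)
    (Matrix.mul_apply_mem (Matrix.mul_apply_mem hB.1 hY) hB.2 i j)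

/-- the key computation in the patching theorem. If
`δ(Y_i)·Y_i⁻¹` has entries in `F_i` (`i = 1,2`), `B_i` is invertible with entries
in `F_i`, and `Y₁·Y₂⁻¹ = B₁⁻¹·B₂`, then `Y := B₁·Y₁ = B₂·Y₂` and
`A := δ(Y)·Y⁻¹` has all entries in `F = F₁ ∩ F₂`. -/
theorem patching_matrix_computation {F₀ : Type*} [Field F₀] [CharZero F₀]
    (δ : Derivation ℤ F₀ F₀) (F₁ F₂ : Subfield F₀)
    (hδ₁ : ∀ x ∈ F₁, δ x ∈ F₁) (hδ₂ : ∀ x ∈ F₂, δ x ∈ F₂)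
    (n : ℕ) (hn : 1 ≤ n)
    (Y₁ Y₂ : GL (Fin n) F₀)
    (hY₁ : ∀ i j, (((Y₁ : Matrix (Fin n) (Fin n) F₀).map δ) *
      ((Y₁⁻¹ : GL (Fin n) F₀) : Matrix (Fin n) (Fin n) F₀)) i j ∈ F₁)
    (hY₂ : ∀ i j, (((Y₂ : Matrix (Fin n) (Fin n) F₀).map δ) *
      ((Y₂⁻¹ : GL (Fin n) F₀) : Matrix (Fin n) (Fin n) F₀)) i j ∈ F₂)
    (B₁ B₂ : GL (Fin n) F₀)
    (hB₁ : GLEntriesIn' B₁ F₁) (hB₂ : GLEntriesIn' B₂ F₂)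
    (hfac : Y₁ * Y₂⁻¹ = B₁⁻¹ * B₂) :
    B₁ * Y₁ = B₂ * Y₂ ∧
      ∀ i j, ((((B₁ * Y₁ : GL (Fin n) F₀) : Matrix (Fin n) (Fin n) F₀).map δ) *
        (((B₁ * Y₁)⁻¹ : GL (Fin n) F₀) : Matrix (Fin n) (Fin n) F₀)) i j ∈ F₁ ⊓ F₂ := by
  have hY : B₁ * Y₁ = B₂ * Y₂ := by
    rw [eq_inv_mul_iff_mul_eq, ← mul_assoc, mul_inv_eq_iff_eq_mul] at hfac
    exact hfac
  refine ⟨hY, fun i j => Subfield.mem_inf.mpr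
    ⟨hB₁.map_derivation_mul_mul_inv_mem hδ₁ hY₁ i j, ?_⟩⟩
  rw [hY]
  exact hB₂.map_derivation_mul_mul_inv_mem hδ₂ hY₂ i j
end

section
/- Let F ⊆ E be fields of characteristic zero. Let δ : E → E be a derivation with δ(F) ⊆ F, and let σ : E → E be an injective ring homomorphism with σ(F) ⊆ F, such that δ(σ(r)) = ħ·σ(δ(r)) for all r ∈ E, where ħ ∈ E is a fixed nonzero element with δ(ħ) = 0. Assume that {e ∈ E : δ(e) = 0} = {f ∈ F : δ(f) = 0} (the δ-constants of E all lie in F). Let n ≥ 1, let A be an n×n matrix with entries in F, and let Y be an invertible n×n matrix over E with δ(Y) = A·Y (δ applied entrywise). Let R be the smallest F-subalgebra of E containing the entries of σ^i(Y) and the elements det(σ^i(Y))^{−1} for all i ≥ 0 (σ applied entrywise). Then: (a) δ(R) ⊆ R and σ(R) ⊆ R; (b) R is δ-simple, i.e., the only ideals I of R with δ(I) ⊆ I are 0 and R; and (c) {x ∈ R : δ(x) = 0} = {f ∈ F : δ(f) = 0}. -/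
open scoped Matrix Kronecker

namespace LinearDifferentialSystem

section Leibniz

variable {E : Type*} [CommRing E] (δ : Derivation ℤ E E)
  {ι κ μ : Type*}

theorem map_mul_leibniz [Fintype ι] (M : Matrix μ ι E) (N : Matrix ι κ E) :
    (M * N).map δ = M.map δ * N + M * N.map δ := by
  ext i j
  simp only [Matrix.map_apply, Matrix.mul_apply, map_sum, Matrix.add_apply,
    ← Finset.sum_add_distrib, Derivation.leibniz, smul_eq_mul]
  exact Finset.sum_congr rfl fun k _ => by ring

theorem comp_vecMul_leibniz [Fintype ι] (y : ι → E) (M : Matrix ι κ E) :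
    δ ∘ (y ᵥ* M) = (δ ∘ y) ᵥ* M + y ᵥ* M.map δ := by
  ext j
  simp only [Function.comp_apply, Matrix.vecMul, dotProduct, map_sum, Pi.add_apply,
    Matrix.map_apply, ← Finset.sum_add_distrib, Derivation.leibniz, smul_eq_mul]
  exact Finset.sum_congr rfl fun k _ => by ring

theorem dotProduct_leibniz [Fintype ι] (y v : ι → E) :
    δ (y ⬝ᵥ v) = (δ ∘ y) ⬝ᵥ v + y ⬝ᵥ (δ ∘ v) := by
  simp only [Function.comp_apply, dotProduct, map_sum,
    ← Finset.sum_add_distrib, Derivation.leibniz, smul_eq_mul]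
  exact Finset.sum_congr rfl fun k _ => by ring

theorem map_one_eq_zero [DecidableEq ι] : (1 : Matrix ι ι E).map δ = 0 := by
  ext i j
  by_cases h : i = j <;> simp [h]

/-- Up to transposition, the inverse of a fundamental matrix solves the dual system. -/
theorem map_inverse [Fintype ι] [DecidableEq ι] {B W V : Matrix ι ι E} (hWV : W * V = 1)
    (hW : W.map δ = B * W) : V.map δ = -(V * B) := by
  have hVW : V * W = 1 := mul_eq_one_comm.mp hWV
  have h := map_mul_leibniz δ W V
  rw [hWV, map_one_eq_zero, hW, Matrix.mul_assoc, hWV, Matrix.mul_one] at h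
  have h2 : V * (B + W * V.map δ) = 0 := by rw [← h, Matrix.mul_zero]
  rw [Matrix.mul_add, ← Matrix.mul_assoc, hVW, Matrix.one_mul] at h2
  exact eq_neg_of_add_eq_zero_right h2

theorem map_kronecker_leibniz (M : Matrix ι ι E) (N : Matrix κ κ E) :
    (M ⊗ₖ N).map δ = M.map δ ⊗ₖ N + M ⊗ₖ N.map δ := by
  ext i j
  simp only [Matrix.map_apply, Matrix.add_apply, Matrix.kroneckerMap_apply,
    Derivation.leibniz, smul_eq_mul]
  ring

end Leibniz

section Field

variable {E : Type*} [Field E] (δ : Derivation ℤ E E)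

/-- Let `W` be a fundamental matrix of `δ(y) = B·y` and let `P` be a projection whose row space is
stable under the dual connection `y ↦ δ(y) + y·B`. If a row vector in the row space of `P` pairs
nontrivially with the solution `W·c`, then so does a horizontal one. -/
theorem exists_horizontal_dotProduct_eq_one {ι : Type*} [Fintype ι] [DecidableEq ι]
    {B W P : Matrix ι ι E} {c : ι → E} (hW : W.map δ = B * W)
    (hP : P * P = P) (hPB : (P.map δ + P * B) * P = P.map δ + P * B)
    (hc : ∀ i, δ (c i) = 0)
    {y₀ : ι → E} (hy₀ : y₀ ᵥ* P = y₀) (hy₀c : y₀ ⬝ᵥ (W *ᵥ c) ≠ 0) :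
    ∃ y : ι → E, y ᵥ* P = y ∧ y ⬝ᵥ (W *ᵥ c) = 1 ∧ ∀ i, δ ((y ᵥ* W) i) = 0 := by
  classical
  suffices H : ∀ (k : ℕ) (y : ι → E), y ᵥ* P = y → y ⬝ᵥ (W *ᵥ c) = 1 →
      (Finset.univ.filter fun i => (y ᵥ* W) i ≠ 0).card = k →
      ∃ y : ι → E, y ᵥ* P = y ∧ y ⬝ᵥ (W *ᵥ c) = 1 ∧ ∀ i, δ ((y ᵥ* W) i) = 0 by
    refine H _ ((y₀ ⬝ᵥ (W *ᵥ c))⁻¹ • y₀) ?_ ?_ rfl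
    · rw [Matrix.smul_vecMul, hy₀]
    · rw [smul_dotProduct, smul_eq_mul, inv_mul_cancel₀ hy₀c]
  intro k
  induction k using Nat.strong_induction_on with
  | _ k ih =>
    intro y hyP hyc hk
    by_cases hδ : ∀ i, δ ((y ᵥ* W) i) = 0
    · exact ⟨y, hyP, hyc, hδ⟩
    obtain ⟨i, hi⟩ := not_forall.mp hδ
    set z : ι → E := δ ∘ y + y ᵥ* B with hz
    have hzW : z ᵥ* W = δ ∘ (y ᵥ* W) := by
      rw [comp_vecMul_leibniz, hW, hz, Matrix.add_vecMul, Matrix.vecMul_vecMul]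
    have hzP : z ᵥ* P = z := by
      have h : z = (δ ∘ y) ᵥ* P + y ᵥ* (P.map δ + P * B) := by
        conv_lhs => rw [hz, ← hyP, comp_vecMul_leibniz, Matrix.vecMul_vecMul]
        rw [Matrix.vecMul_add, add_assoc]
      rw [h, Matrix.add_vecMul, Matrix.vecMul_vecMul, Matrix.vecMul_vecMul, hP, hPB]
    have hδc : δ ∘ c = 0 := funext hc
    have hzc : z ⬝ᵥ (W *ᵥ c) = 0 := by
      rw [Matrix.dotProduct_mulVec, hzW]
      have h := dotProduct_leibniz δ (y ᵥ* W) c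
      rwa [hδc, dotProduct_zero, add_zero, ← Matrix.dotProduct_mulVec, hyc,
        Derivation.map_one_eq_zero, eq_comm] at h
    have hsupp : ∀ j, (y ᵥ* W) j = 0 → (z ᵥ* W) j = 0 := fun j hj => by
      rw [hzW, Function.comp_apply, hj, map_zero]
    have hzi : (z ᵥ* W) i ≠ 0 := by rwa [hzW]
    set a : E := (y ᵥ* W) i / (z ᵥ* W) i
    have hW' : ∀ j, ((y - a • z) ᵥ* W) j = (y ᵥ* W) j - a * (z ᵥ* W) j := fun j => by
      rw [Matrix.sub_vecMul, Matrix.smul_vecMul]; rfl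
    refine ih _ ?_ (y - a • z) ?_ ?_ rfl
    · rw [← hk]
      refine Finset.card_lt_card (Finset.ssubset_iff_of_subset ?_ |>.mpr ⟨i, ?_, ?_⟩)
      · intro j
        simp only [Finset.mem_filter, Finset.mem_univ, true_and, hW']
        contrapose!
        intro hj
        rw [hj, hsupp j hj]; simp
      · simpa using fun h => hzi (hsupp i h)
      · simp [hW', a, hzi]
    · rw [Matrix.sub_vecMul, Matrix.smul_vecMul, hyP, hzP]
    · rw [sub_dotProduct, smul_dotProduct, hyc, hzc]; simp

variable (F : Subfield E) (R : Subalgebra F E)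

/-- `f` is an `F`-linear combination of the entries of a solution of a linear differential system
over `F` having a fundamental matrix in `GL(R)`. -/
def IsSolutionCombination (f : E) : Prop :=
  ∃ (ι : Type) (_ : Fintype ι) (_ : DecidableEq ι) (B W V : Matrix ι ι E) (l c : ι → E),
    (∀ i j, B i j ∈ F) ∧ (∀ i j, W i j ∈ R) ∧ (∀ i j, V i j ∈ R) ∧ W * V = 1 ∧
    W.map δ = B * W ∧ (∀ i, l i ∈ F) ∧ (∀ i, δ (c i) = 0) ∧ f = l ⬝ᵥ (W *ᵥ c)

variable {δ F R}

theorem mem_of_mem_subfield {x : E} (hx : x ∈ F) : x ∈ R := R.algebraMap_mem ⟨x, hx⟩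

theorem det_mem {ι : Type*} [Fintype ι] [DecidableEq ι] {M : Matrix ι ι E}
    (hM : ∀ i j, M i j ∈ R) : M.det ∈ R := by
  rw [Matrix.det_apply']
  exact R.sum_mem fun τ _ => R.mul_mem (intCast_mem R _) (R.prod_mem fun _ _ => hM _ _)

theorem isSolutionCombination_entry {ι : Type} [Fintype ι] [DecidableEq ι]
    {B W V : Matrix ι ι E} (hB : ∀ i j, B i j ∈ F) (hWR : ∀ i j, W i j ∈ R)
    (hVR : ∀ i j, V i j ∈ R) (hWV : W * V = 1) (hW : W.map δ = B * W) (i j : ι) :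
    IsSolutionCombination δ F R (W i j) := by
  refine ⟨ι, _, _, B, W, V, Pi.single i 1, Pi.single j 1, hB, hWR, hVR, hWV, hW, ?_, ?_, ?_⟩
  · intro k
    by_cases h : k = i
    · subst h; simp [F.one_mem]
    · simp [h, F.zero_mem]
  · intro k
    by_cases h : k = j
    · subst h; simp
    · simp [h]
  · simp

theorem isSolutionCombination_of_mem {x : E} (hx : x ∈ F) : IsSolutionCombination δ F R x := by
  refine ⟨Unit, _, inferInstance, 0, 1, 1, fun _ => x, fun _ => 1, fun _ _ => F.zero_mem,
    fun _ _ => ?_, fun _ _ => ?_, one_mul _, ?_, fun _ => hx, fun _ => δ.map_one_eq_zero, ?_⟩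
  · simp [R.one_mem]
  · simp [R.one_mem]
  · rw [map_one_eq_zero, Matrix.zero_mul]
  · simp [dotProduct]

namespace IsSolutionCombination

theorem add {f g : E} (hf : IsSolutionCombination δ F R f) (hg : IsSolutionCombination δ F R g) :
    IsSolutionCombination δ F R (f + g) := by
  obtain ⟨ι, _, _, B, W, V, l, c, hB, hWR, hVR, hWV, hW, hl, hc, rfl⟩ := hf
  obtain ⟨κ, _, _, B', W', V', l', c', hB', hWR', hVR', hWV', hW', hl', hc', rfl⟩ := hg
  refine ⟨ι ⊕ κ, inferInstance, inferInstance, Matrix.fromBlocks B 0 0 B',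
    Matrix.fromBlocks W 0 0 W', Matrix.fromBlocks V 0 0 V', Sum.elim l l', Sum.elim c c',
    ?_, ?_, ?_, ?_, ?_, ?_, ?_, ?_⟩
  · rintro (i | i) (j | j) <;> simp [hB, hB', F.zero_mem]
  · rintro (i | i) (j | j) <;> simp [hWR, hWR', R.zero_mem]
  · rintro (i | i) (j | j) <;> simp [hVR, hVR', R.zero_mem]
  · simp [Matrix.fromBlocks_multiply, hWV, hWV']
  · rw [Matrix.fromBlocks_map, Matrix.fromBlocks_multiply, hW, hW']
    simp [Matrix.map_zero]
  · rintro (i | i) <;> simp [hl, hl']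
  · rintro (i | i) <;> simp [hc, hc']
  · simp [Matrix.fromBlocks_mulVec, dotProduct]

theorem mul {f g : E} (hf : IsSolutionCombination δ F R f) (hg : IsSolutionCombination δ F R g) :
    IsSolutionCombination δ F R (f * g) := by
  obtain ⟨ι, _, _, B, W, V, l, c, hB, hWR, hVR, hWV, hW, hl, hc, rfl⟩ := hf
  obtain ⟨κ, _, _, B', W', V', l', c', hB', hWR', hVR', hWV', hW', hl', hc', rfl⟩ := hg
  refine ⟨ι × κ, inferInstance, inferInstance,
    B ⊗ₖ (1 : Matrix κ κ E) + (1 : Matrix ι ι E) ⊗ₖ B', W ⊗ₖ W', V ⊗ₖ V',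
    fun p => l p.1 * l' p.2, fun p => c p.1 * c' p.2, ?_, ?_, ?_, ?_, ?_, ?_, ?_, ?_⟩
  · rintro ⟨i, i'⟩ ⟨j, j'⟩
    have h1 : ∀ (α : Type) [DecidableEq α] (a b : α), (1 : Matrix α α E) a b ∈ F := by
      intro α _ a b
      by_cases h : a = b <;> simp [Matrix.one_apply, h, F.zero_mem, F.one_mem]
    exact F.add_mem (F.mul_mem (hB _ _) (h1 _ _ _)) (F.mul_mem (h1 _ _ _) (hB' _ _))
  · rintro ⟨i, i'⟩ ⟨j, j'⟩
    exact R.mul_mem (hWR _ _) (hWR' _ _)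
  · rintro ⟨i, i'⟩ ⟨j, j'⟩
    exact R.mul_mem (hVR _ _) (hVR' _ _)
  · rw [← Matrix.mul_kronecker_mul, hWV, hWV', Matrix.one_kronecker_one]
  · rw [map_kronecker_leibniz, hW, hW', Matrix.add_mul, ← Matrix.mul_kronecker_mul,
      ← Matrix.mul_kronecker_mul, Matrix.one_mul, Matrix.one_mul]
  · exact fun p => F.mul_mem (hl _) (hl' _)
  · intro p
    simp [hc, hc']
  · have h : (W ⊗ₖ W') *ᵥ (fun p => c p.1 * c' p.2) =
        fun p => (W *ᵥ c) p.1 * (W' *ᵥ c') p.2 := by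
      ext p
      simp only [Matrix.mulVec, dotProduct, Matrix.kroneckerMap_apply, Fintype.sum_prod_type,
        Finset.sum_mul_sum, mul_mul_mul_comm]
    rw [h]
    simp only [dotProduct, Fintype.sum_prod_type, Finset.sum_mul_sum, mul_mul_mul_comm]

theorem derivation_mem (hδF : ∀ x ∈ F, δ x ∈ F) (hC : ∀ x, δ x = 0 → x ∈ F) {f : E}
    (hf : IsSolutionCombination δ F R f) : δ f ∈ R := by
  obtain ⟨ι, _, _, B, W, V, l, c, hB, hWR, hVR, hWV, hW, hl, hc, rfl⟩ := hf
  have hδc : δ ∘ c = 0 := funext hc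
  rw [Matrix.dotProduct_mulVec, dotProduct_leibniz, hδc, dotProduct_zero, add_zero,
    comp_vecMul_leibniz, hW]
  have hcR : ∀ i, c i ∈ R := fun i => mem_of_mem_subfield (hC _ (hc i))
  have hlR : ∀ i, l i ∈ R := fun i => mem_of_mem_subfield (hl i)
  have hδlR : ∀ i, δ (l i) ∈ R := fun i => mem_of_mem_subfield (hδF _ (hl i))
  have hBR : ∀ i j, B i j ∈ R := fun i j => mem_of_mem_subfield (hB i j)
  refine R.sum_mem fun j _ => R.mul_mem (R.add_mem ?_ ?_) (hcR j)
  · exact R.sum_mem fun i _ => R.mul_mem (hδlR i) (hWR i j)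
  · exact R.sum_mem fun i _ => R.mul_mem (hlR i)
      (R.sum_mem fun k _ => R.mul_mem (hBR i k) (hWR k j))

/-- A nonzero solution combination generates the unit `δ`-ideal. -/
theorem eq_top_of_mem (hδF : ∀ x ∈ F, δ x ∈ F) (hC : ∀ x, δ x = 0 → x ∈ F) {I : Ideal R}
    (hI : ∀ x : R, x ∈ I → ∀ y : R, (y : E) = δ (x : E) → y ∈ I) {f : R} (hfI : f ∈ I)
    (hf0 : f ≠ 0) (hf : IsSolutionCombination δ F R f) : I = ⊤ := by
  obtain ⟨ι, _, _, B, W, V, l, c, hB, hWR, hVR, hWV, hW, hl, hc, hf⟩ := hf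
  have hδc : δ ∘ c = 0 := funext hc
  have hcR : ∀ i, c i ∈ R := fun i => mem_of_mem_subfield (hC _ (hc i))
  have hvR : ∀ i, (W *ᵥ c) i ∈ R := fun i => R.sum_mem fun j _ => R.mul_mem (hWR i j) (hcR j)
  let v : ι → R := fun i => ⟨(W *ᵥ c) i, hvR i⟩
  let N : Submodule F (ι → F) := (I.restrictScalars F).comap (Fintype.linearCombination F v)
  have hcoe : ∀ u : ι → F,
      ((Fintype.linearCombination F v u : R) : E) = (fun i => (u i : E)) ⬝ᵥ (W *ᵥ c) := by
    intro u
    simp [Fintype.linearCombination_apply, dotProduct, v, Algebra.smul_def]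
    rfl
  let D : (ι → F) → (ι → F) := fun u j =>
    ⟨δ (u j) + ∑ i, (u i : E) * B i j,
      F.add_mem (hδF _ (u j).2) (F.sum_mem fun i _ => F.mul_mem (u i).2 (hB i j))⟩
  have hDN : ∀ u ∈ N, D u ∈ N := by
    intro u hu
    refine hI _ hu _ ?_
    have hD : (fun i => (D u i : E)) = δ ∘ (fun i => (u i : E)) + (fun i => (u i : E)) ᵥ* B := rfl
    rw [hcoe, hcoe, hD, Matrix.dotProduct_mulVec, Matrix.dotProduct_mulVec, dotProduct_leibniz,
      hδc, dotProduct_zero, add_zero, comp_vecMul_leibniz, hW, Matrix.add_vecMul,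
      Matrix.vecMul_vecMul]
  obtain ⟨p, hp⟩ := N.subtype.exists_leftInverse_of_injective N.ker_subtype
  have hpN : ∀ u (hu : u ∈ N), ((p u : N) : ι → F) = u := fun u hu =>
    congrArg Subtype.val (LinearMap.congr_fun hp ⟨u, hu⟩)
  let q : ι → ι → F := fun i => (p (Pi.single i 1) : N)
  have hqN : ∀ i, q i ∈ N := fun i => (p (Pi.single i 1)).2
  let P : Matrix ι ι E := Matrix.of fun i j => (q i j : E)
  have hNP : ∀ u ∈ N, (fun i => (u i : E)) ᵥ* P = fun i => (u i : E) := by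
    intro u hu
    have h : u = ∑ i, u i • q i := by
      conv_lhs => rw [← hpN u hu, pi_eq_sum_univ' u]
      simp only [map_sum, map_smul, Submodule.coe_sum, Submodule.coe_smul, q]
    ext j
    have hj := congrArg (fun w : ι → F => (w j : E)) h
    simp only [Finset.sum_apply, Pi.smul_apply, smul_eq_mul] at hj
    rw [hj]
    push_cast
    rfl
  have hPP : P * P = P := by
    ext i j
    exact congrFun (hNP (q i) (hqN i)) j
  have hPB : (P.map δ + P * B) * P = P.map δ + P * B := by
    ext i j
    exact congrFun (hNP (D (q i)) (hDN _ (hqN i))) j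
  have hlN : (fun i => (⟨l i, hl i⟩ : F)) ∈ N := by
    have h : Fintype.linearCombination F v (fun i => (⟨l i, hl i⟩ : F)) = f :=
      Subtype.ext ((hcoe _).trans hf.symm)
    change Fintype.linearCombination F v _ ∈ I
    rwa [h]
  obtain ⟨y, hyP, hyc, hy⟩ := exists_horizontal_dotProduct_eq_one δ hW hPP hPB hc
    (hNP _ hlN) (hf ▸ fun h => hf0 (Subtype.ext h))
  have hyR : ∀ i, y i ∈ R := by
    intro i
    have h : y = (y ᵥ* W) ᵥ* V := by rw [Matrix.vecMul_vecMul, hWV, Matrix.vecMul_one]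
    rw [h]
    exact R.sum_mem fun j _ => R.mul_mem (mem_of_mem_subfield (hC _ (hy j))) (hVR j i)
  rw [Ideal.eq_top_iff_one]
  have h1 : (1 : R) = ∑ i, (⟨y i, hyR i⟩ : R) * Fintype.linearCombination F v (q i) := by
    apply Subtype.ext
    rw [AddSubmonoidClass.coe_finsetSum]
    simp only [MulMemClass.coe_mul, hcoe]
    rw [← hyP, ← Matrix.dotProduct_mulVec] at hyc
    exact hyc.symm
  rw [h1]
  exact I.sum_mem fun i _ => I.mul_mem_left _ (hqN i)

end IsSolutionCombination

end Field

end LinearDifferentialSystem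

open scoped Matrix in
/-- Let `E/F` be an extension of `δσ`-fields of characteristic zero
whose `δ`-constants all lie in `F`. If `δ(Y) = A·Y` with `A` over `F` and
`Y ∈ GL_n(E)`, then `R = F{Y, 1/det Y}` (the smallest `F`-subalgebra of `E`
containing the entries of `σ^i(Y)` and the `det(σ^i(Y))⁻¹` for all `i ≥ 0`)
is a `σ`-Picard-Vessiot ring: it is `δ`- and `σ`-stable, `δ`-simple, and its
`δ`-constants are those of `F`. -/
theorem sigma_picard_vessiot_ring {E : Type*} [Field E] [CharZero E]
    (δ : Derivation ℤ E E) (σ : E →+* E) (hσinj : Function.Injective σ)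
    (ℏ : E) (hℏ : ℏ ≠ 0) (hδℏ : δ ℏ = 0)
    (hcomm : ∀ r : E, δ (σ r) = ℏ * σ (δ r))
    (F : Subfield E) (hδF : ∀ x ∈ F, δ x ∈ F) (hσF : ∀ x ∈ F, σ x ∈ F)
    (hconst : {e : E | δ e = 0} = {e : E | e ∈ F ∧ δ e = 0})
    (n : ℕ) (hn : 1 ≤ n)
    (A : Matrix (Fin n) (Fin n) E) (hA : ∀ i j, A i j ∈ F)
    (Y : GL (Fin n) E)
    (hY : (Y : Matrix (Fin n) (Fin n) E).map δ = A * (Y : Matrix (Fin n) (Fin n) E))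
    (R : Subalgebra F E)
    (hR : R = Algebra.adjoin F
      ({e : E | ∃ (i : ℕ) (k l : Fin n), e = (⇑σ)^[i] ((Y : Matrix (Fin n) (Fin n) E) k l)} ∪
       {e : E | ∃ i : ℕ, e = (((Y : Matrix (Fin n) (Fin n) E).map ((⇑σ)^[i])).det)⁻¹})) :
    (∀ x : E, x ∈ R → δ x ∈ R ∧ σ x ∈ R) ∧
    (∀ I : Ideal R, (∀ x : R, x ∈ I → ∀ y : R, (y : E) = δ (x : E) → y ∈ I) →
      I = ⊥ ∨ I = ⊤) ∧
    ({e : E | e ∈ R ∧ δ e = 0} = {e : E | e ∈ F ∧ δ e = 0}) := by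
  have hC : ∀ x, δ x = 0 → x ∈ F := fun x hx => (hconst.subset hx).1
  have hδσ : ∀ i : ℕ, ∃ h ∈ F, ∀ r, δ ((⇑σ)^[i] r) = h * (⇑σ)^[i] (δ r) := by
    intro i
    induction i with
    | zero => exact ⟨1, F.one_mem, fun r => by simp⟩
    | succ i ih =>
      obtain ⟨h, hF, hh⟩ := ih
      refine ⟨ℏ * σ h, F.mul_mem (hC _ hδℏ) (hσF _ hF), fun r => ?_⟩
      rw [Function.iterate_succ_apply', Function.iterate_succ_apply', hcomm, hh, map_mul, mul_assoc]
  have hσiF : ∀ (i : ℕ), ∀ x ∈ F, (⇑σ)^[i] x ∈ F := by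
    intro i x hx
    induction i with
    | zero => exact hx
    | succ i ih => rw [Function.iterate_succ_apply']; exact hσF _ ih
  set Z : ℕ → Matrix (Fin n) (Fin n) E :=
    fun i => (Y : Matrix (Fin n) (Fin n) E).map (⇑σ)^[i] with hZ
  have hpow : ∀ i : ℕ, (⇑σ)^[i] = ⇑(σ ^ i) := fun i => (RingHom.coe_pow σ i).symm
  have hdet : ∀ i, (Z i).det ≠ 0 := by
    intro i
    have h : Z i = (σ ^ i).mapMatrix (Y : Matrix (Fin n) (Fin n) E) := by
      rw [hZ, RingHom.mapMatrix_apply, ← hpow]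
    rw [h, ← RingHom.map_det]
    exact (map_ne_zero _).mpr ((Matrix.isUnit_iff_isUnit_det _).mp Y.isUnit).ne_zero
  have hZinv : ∀ i, Z i * (Z i)⁻¹ = 1 := fun i =>
    Matrix.mul_nonsing_inv _ (isUnit_iff_ne_zero.mpr (hdet i))
  have hZR : ∀ i k l, Z i k l ∈ R := by
    intro i k l
    rw [hR]
    exact Algebra.subset_adjoin (Or.inl ⟨i, k, l, rfl⟩)
  have hdetR : ∀ i, ((Z i).det)⁻¹ ∈ R := by
    intro i
    rw [hR]
    exact Algebra.subset_adjoin (Or.inr ⟨i, rfl⟩)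
  have hZinvR : ∀ i k l, (Z i)⁻¹ k l ∈ R := by
    intro i k l
    rw [Matrix.inv_def, Ring.inverse_eq_inv', Matrix.smul_apply, smul_eq_mul]
    refine R.mul_mem (hdetR i) ?_
    rw [Matrix.adjugate_apply]
    refine LinearDifferentialSystem.det_mem fun a b => ?_
    rw [Matrix.updateRow_apply]
    split_ifs
    · by_cases h : b = k
      · subst h; simp [R.one_mem]
      · simp [h, R.zero_mem]
    · exact hZR i a b
  have hZδ : ∀ i, ∃ B : Matrix (Fin n) (Fin n) E, (∀ k l, B k l ∈ F) ∧
      (Z i).map δ = B * Z i := by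
    intro i
    obtain ⟨h, hF, hh⟩ := hδσ i
    refine ⟨h • A.map (⇑σ)^[i], fun k l => F.mul_mem hF (hσiF i _ (hA k l)), ?_⟩
    have h1 : (Z i).map δ = h • ((Y : Matrix (Fin n) (Fin n) E).map δ).map (⇑σ)^[i] := by
      ext k l
      exact hh _
    rw [h1, hY, hpow, Matrix.map_mul, Matrix.smul_mul]
    simp only [hZ, hpow]
  have hsol : ∀ x ∈ R, LinearDifferentialSystem.IsSolutionCombination δ F R x := by
    let T : Subalgebra F E :=
      { carrier := {x | LinearDifferentialSystem.IsSolutionCombination δ F R x}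
        mul_mem' := fun ha hb => ha.mul hb
        add_mem' := fun ha hb => ha.add hb
        algebraMap_mem' := fun r => LinearDifferentialSystem.isSolutionCombination_of_mem r.2 }
    suffices h : R ≤ T from fun x hx => h hx
    conv_lhs => rw [hR]
    refine Algebra.adjoin_le ?_
    rintro _ (⟨i, k, l, rfl⟩ | ⟨i, rfl⟩)
    · obtain ⟨B, hB, hZB⟩ := hZδ i
      exact LinearDifferentialSystem.isSolutionCombination_entry hB (hZR i) (hZinvR i) (hZinv i)
        hZB k l
    · obtain ⟨B, hB, hZB⟩ := hZδ i
      have hinv : ∀ k l, (Z i)⁻¹ k l ∈ T := by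
        intro k l
        refine LinearDifferentialSystem.isSolutionCombination_entry (B := -Bᵀ) (W := ((Z i)⁻¹)ᵀ)
          (V := (Z i)ᵀ) (fun a b => F.neg_mem (hB b a)) (fun a b => hZinvR i b a)
          (fun a b => hZR i b a) ?_ ?_ l k
        · rw [← Matrix.transpose_mul, hZinv, Matrix.transpose_one]
        · rw [Matrix.transpose_map, LinearDifferentialSystem.map_inverse δ (hZinv i) hZB,
            Matrix.transpose_neg, Matrix.transpose_mul, Matrix.neg_mul]
      change ((Z i).det)⁻¹ ∈ T
      rw [← Ring.inverse_eq_inv', ← Matrix.det_nonsing_inv]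
      exact LinearDifferentialSystem.det_mem hinv
  have hσR : ∀ x ∈ R, σ x ∈ R := by
    intro x hx
    rw [hR] at hx
    induction hx using Algebra.adjoin_induction with
    | mem x hx =>
      obtain ⟨i, k, l, rfl⟩ | ⟨i, rfl⟩ := hx
      · rw [← Function.iterate_succ_apply' (⇑σ)]
        exact hZR (i + 1) k l
      · have h : σ (((Y : Matrix (Fin n) (Fin n) E).map (⇑σ)^[i]).det)⁻¹ = ((Z (i + 1)).det)⁻¹ := by
          rw [map_inv₀, RingHom.map_det, RingHom.mapMatrix_apply, Matrix.map_map,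
            ← Function.iterate_succ']
        rw [h]
        exact hdetR (i + 1)
    | algebraMap r => exact LinearDifferentialSystem.mem_of_mem_subfield (hσF _ r.2)
    | add x y _ _ hx hy => rw [map_add]; exact R.add_mem hx hy
    | mul x y _ _ hx hy => rw [map_mul]; exact R.mul_mem hx hy
  refine ⟨fun x hx => ⟨(hsol x hx).derivation_mem hδF hC, hσR x hx⟩, fun I hI => ?_, ?_⟩
  · refine or_iff_not_imp_left.mpr fun hne => ?_
    obtain ⟨f, hfI, hf0⟩ := Submodule.exists_mem_ne_zero_of_ne_bot hne
    exact LinearDifferentialSystem.IsSolutionCombination.eq_top_of_mem hδF hC hI hfI hf0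
      (hsol f f.2)
  · ext e
    exact ⟨fun h => ⟨hC e h.2, h.2⟩,
      fun h => ⟨LinearDifferentialSystem.mem_of_mem_subfield h.1, h.2⟩⟩
end
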